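/- Let G be a finite simple graph with a proper 3-coloring of its vertices by colors I, II, III, and orient every edge of G from the endpoint with the smaller color to the endpoint with the larger color (from I to II and III, and from II to III, under the order I < II < III). Then the resulting orientation of G is semi-transitive. -/

import Mathlib

def IsOrientation {V : Type*} (G : SimpleGraph V) (R : V → V → Prop) : Prop :=
  (∀ x y : V, R x y → G.Adj x y) ∧ ∀ x y : V, G.Adj x y → (R x y ↔ ¬ R y x)

/-- A relation is semi-transitive if it is acyclic and, for every directed path
`v 0 → v 1 → ⋯ → v (k-1)` on `k ≥ 4` vertices, whenever the edge `v 0 → v (k-1)`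
is present, all edges `v i → v j` for `i < j < k` are present (no shortcuts). -/
def IsSemiTransitive {V : Type*} (R : V → V → Prop) : Prop :=
  (∀ v : V, ¬ Relation.TransGen R v v) ∧
  ∀ k : ℕ, 4 ≤ k → ∀ v : ℕ → V,
    (∀ i, i + 1 < k → R (v i) (v (i + 1))) →
    R (v 0) (v (k - 1)) →
    ∀ i j, i < j → j < k → R (v i) (v j)

theorem orientation_from_coloring_semiTransitive {V : Type*} [Fintype V] (G : SimpleGraph V)
    (c : V → Fin 3) (hc : ∀ x y : V, G.Adj x y → c x ≠ c y) :
    IsOrientation G (fun x y => G.Adj x y ∧ c x < c y) ∧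
      IsSemiTransitive (fun x y : V => G.Adj x y ∧ c x < c y) := by
  refine ⟨⟨fun x y h => h.1, fun x y h => ?_⟩, ?_, ?_⟩
  · have h1 := hc x y h
    constructor
    · rintro ⟨_, h2⟩ ⟨_, h3⟩
      exact absurd h2 (not_lt.mpr h3.le)
    · intro h2
      refine ⟨h, lt_of_le_of_ne (not_lt.mp fun h3 => h2 ⟨h.symm, h3⟩) h1⟩
  · intro v hv
    have key : ∀ w, Relation.TransGen (fun x y : V => G.Adj x y ∧ c x < c y) v w → c v < c w := by
      intro w hw
      induction hw with
      | single h => exact h.2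
      | tail _ h ih => exact ih.trans h.2
    exact lt_irrefl _ (key v hv)
  · intro k hk v hv _ i j _ _
    exfalso
    have h0 := (hv 0 (by omega)).2
    have h1 := (hv 1 (by omega)).2
    have h2 := (hv 2 (by omega)).2
    simp only [Fin.lt_def, Nat.zero_add, Nat.reduceAdd] at h0 h1 h2
    have h3 := (c (v 3)).isLt
    omega
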